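/- arXiv:2406.10368 — 5 statements merged into one kernel-verified Lean document; each statement's English description precedes it below -/
import Mathlib

section
/- Let C and Y be finite sets, β : C → Y a function, and S ⊆ C a subset (the support of the training distribution over ground-truth concepts). The number of maps α : C → C satisfying β(α(c)) = β(c) for every c ∈ S equals (∏_{c ∈ S} |E(c)|) · |C|^{|C| − |S|}, where E(c) = {c' ∈ C : β(c') = β(c)}. In particular, when the support is not exhaustive (S ≠ C) the count acquires an extra factor of |C| for every concept vector missing from the support. -/
/-- For a (possibly non-exhaustive) support `S ⊆ C`, the number of
maps `α : C → C` with `β (α c) = β c` for all `c ∈ S` equals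
`(∏_{c ∈ S} |E(c)|) · |C|^{|C| - |S|}`. -/
theorem stmt_2 {C Y : Type*} [Fintype C] [Fintype Y] [DecidableEq C] [DecidableEq Y]
    (β : C → Y) (S : Finset C) :
    Fintype.card {α : C → C // ∀ c ∈ S, β (α c) = β c} =
      (∏ c ∈ S, (Finset.univ.filter fun c' => β c' = β c).card) *
        (Fintype.card C) ^ (Fintype.card C - S.card) := by
  have h : (Finset.univ.filter fun α : C → C => ∀ c ∈ S, β (α c) = β c) =
      Fintype.piFinset fun c =>
        if c ∈ S then Finset.univ.filter (fun c' => β c' = β c) else Finset.univ := by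
    ext α
    simp only [Finset.mem_filter, Finset.mem_univ, true_and, Fintype.mem_piFinset]
    refine forall_congr' fun c => ?_
    by_cases hc : c ∈ S <;> simp [hc]
  rw [Fintype.card_subtype, h, Fintype.card_piFinset, ← Finset.prod_mul_prod_compl S]
  congr 1
  · exact Finset.prod_congr rfl fun c hc => by rw [if_pos hc]
  · rw [← Finset.card_compl, ← Finset.card_univ (α := C)]
    exact Finset.prod_eq_pow_card fun c hc => by rw [if_neg (Finset.mem_compl.mp hc)]
end

section
/- For the 3-bit AND task with β(c₁,c₂,c₃) = c₁ ∧ c₂ ∧ c₃ and exhaustive support S = {0,1}³, the number of pairs (π, (g₁,g₂,g₃)), where π is a permutation of {1,2,3} and each gᵢ : {0,1} → {0,1} is an arbitrary unary Boolean function, such that the factored map α(c) = (g₁(c_{π(1)}), g₂(c_{π(2)}), g₃(c_{π(3)})) satisfies β(α(c)) = β(c) for all c ∈ {0,1}³, is exactly 6 (namely the 6 permutations with all gᵢ the identity). -/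
/-- A factored map preserves the conjunction of all coordinates exactly when every unary
function is the identity, whatever the permutation of the coordinates. -/
theorem forall_factored_eq_true_iff {ι : Type*} (π : Equiv.Perm ι) (g : ι → Bool → Bool) :
    (∀ c : ι → Bool, (∀ i, g i (c (π i)) = true) ↔ ∀ i, c i = true) ↔ g = fun _ => id := by
  classical
  constructor
  · intro h
    have h_true : ∀ i, g i true = true := (h fun _ => true).2 fun _ => rfl
    funext i b
    cases b
    · by_contra hi
      have hi' : g i false = true := by simpa using hi
      have := (h (Function.update (fun _ => true) (π i) false)).1 (fun j => by
        by_cases hj : j = i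
        · subst hj
          simpa using hi'
        · simpa [Function.update_of_ne (π.injective.ne hj)] using h_true j) (π i)
      simp at this
    · exact h_true i
  · rintro rfl c
    exact π.forall_congr_left.trans (by simp)

theorem and_fin_three_eq_iff (a b : Fin 3 → Bool) :
    ((a 0 && a 1) && a 2) = ((b 0 && b 1) && b 2) ↔
      ((∀ i, a i = true) ↔ ∀ i, b i = true) := by
  rw [Bool.eq_iff_iff]
  simp [Fin.forall_fin_succ, and_assoc]

/-- For the 3-bit AND task with exhaustive support, the number of
factored maps `α(c)ᵢ = gᵢ(c_{π(i)})` (with `π` a permutation of the three bits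
and each `gᵢ : Bool → Bool` arbitrary) satisfying `β (α c) = β c` for all
`c ∈ {0,1}³`, where `β c = c₁ ∧ c₂ ∧ c₃`, is exactly `6`. -/
theorem stmt_5 :
    Fintype.card
      {p : Equiv.Perm (Fin 3) × (Fin 3 → Bool → Bool) //
        ∀ c : Fin 3 → Bool,
          (((fun i : Fin 3 => p.2 i (c (p.1 i))) 0 &&
              (fun i : Fin 3 => p.2 i (c (p.1 i))) 1) &&
              (fun i : Fin 3 => p.2 i (c (p.1 i))) 2) =
            ((c 0 && c 1) && c 2)} = 6 := by
  rw [← Nat.card_eq_fintype_card]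
  have key : ∀ p : Equiv.Perm (Fin 3) × (Fin 3 → Bool → Bool),
      (∀ c : Fin 3 → Bool,
        (((fun i : Fin 3 => p.2 i (c (p.1 i))) 0 &&
            (fun i : Fin 3 => p.2 i (c (p.1 i))) 1) &&
            (fun i : Fin 3 => p.2 i (c (p.1 i))) 2) =
          ((c 0 && c 1) && c 2)) ↔ p.2 = fun _ => id := fun p =>
    (forall_congr' fun c => and_fin_three_eq_iff (fun i => p.2 i (c (p.1 i))) c).trans
      (forall_factored_eq_true_iff p.1 p.2)
  let e : {p : Equiv.Perm (Fin 3) × (Fin 3 → Bool → Bool) // p.2 = fun _ => id} ≃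
      Equiv.Perm (Fin 3) :=
    { toFun := fun p => p.1.1
      invFun := fun π => ⟨(π, fun _ => id), rfl⟩
      left_inv := fun ⟨_, h⟩ => Subtype.ext (Prod.ext rfl h.symm)
      right_inv := fun _ => rfl }
  rw [Nat.card_congr ((Equiv.subtypeEquivRight key).trans e), Nat.card_perm, Nat.card_fin]
  rfl
end

section
/- For the 3-bit XOR task with β(c₁,c₂,c₃) = c₁ ⊕ c₂ ⊕ c₃ and exhaustive support S = {0,1}³, the number of pairs (π, (g₁,g₂,g₃)), where π is a permutation of {1,2,3} and each gᵢ : {0,1} → {0,1} is an arbitrary unary Boolean function, such that the factored map α(c) = (g₁(c_{π(1)}), g₂(c_{π(2)}), g₃(c_{π(3)})) satisfies β(α(c)) = β(c) for all c ∈ {0,1}³, is exactly 24. In particular, the 3-bit XOR task admits strictly more optimal maps (24) than the 3-bit AND task (6) under exhaustive support. -/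
theorem xor_fin_three_comp_perm (e : Equiv.Perm (Fin 3)) (c : Fin 3 → Bool) :
    Bool.xor (Bool.xor (c (e 0)) (c (e 1))) (c (e 2)) =
      Bool.xor (Bool.xor (c 0) (c 1)) (c 2) := by
  revert e c
  decide

theorem and_fin_three_comp_perm (e : Equiv.Perm (Fin 3)) (c : Fin 3 → Bool) :
    ((c (e 0) && c (e 1)) && c (e 2)) = ((c 0 && c 1) && c 2) := by
  revert e c
  decide

/-- If `β` is symmetric, a factored map preserves `β` if and only if its unary components do,
whatever the permutation; so the permutation contributes a factor `6` to the count. -/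
theorem card_factored_maps (β : (Fin 3 → Bool) → Bool)
    (hβ : ∀ (e : Equiv.Perm (Fin 3)) (c : Fin 3 → Bool), β (fun i => c (e i)) = β c)
    [Fintype {p : Equiv.Perm (Fin 3) × (Fin 3 → Bool → Bool) //
      ∀ c : Fin 3 → Bool, β (fun i => p.2 i (c (p.1 i))) = β c}] :
    Fintype.card {p : Equiv.Perm (Fin 3) × (Fin 3 → Bool → Bool) //
        ∀ c : Fin 3 → Bool, β (fun i => p.2 i (c (p.1 i))) = β c} =
      6 * Fintype.card {g : Fin 3 → Bool → Bool //
        ∀ c : Fin 3 → Bool, β (fun i => g i (c i)) = β c} := by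
  have key (p : Equiv.Perm (Fin 3) × (Fin 3 → Bool → Bool)) :
      (∀ c : Fin 3 → Bool, β (fun i => p.2 i (c (p.1 i))) = β c) ↔
        ∀ c : Fin 3 → Bool, β (fun i => p.2 i (c i)) = β c := by
    refine ⟨fun h c => ?_, fun h c => (h fun i => c (p.1 i)).trans (hβ p.1 c)⟩
    simpa using (h fun i => c (p.1.symm i)).trans (hβ p.1.symm c)
  have e : {p : Equiv.Perm (Fin 3) × (Fin 3 → Bool → Bool) //
        ∀ c : Fin 3 → Bool, β (fun i => p.2 i (c (p.1 i))) = β c} ≃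
      Equiv.Perm (Fin 3) × {g : Fin 3 → Bool → Bool //
        ∀ c : Fin 3 → Bool, β (fun i => g i (c i)) = β c} :=
    { toFun := fun p => (p.1.1, ⟨p.1.2, (key p.1).1 p.2⟩)
      invFun := fun q => ⟨(q.1, q.2.1), (key _).2 q.2.2⟩
      left_inv := fun _ => rfl
      right_inv := fun _ => rfl }
  rw [Fintype.card_congr e, Fintype.card_prod, Fintype.card_perm, Fintype.card_fin]
  rfl

theorem card_xor_preserving :
    Fintype.card {g : Fin 3 → Bool → Bool // ∀ c : Fin 3 → Bool,
      Bool.xor (Bool.xor (g 0 (c 0)) (g 1 (c 1))) (g 2 (c 2)) =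
        Bool.xor (Bool.xor (c 0) (c 1)) (c 2)} = 4 := by
  decide +kernel

theorem card_and_preserving :
    Fintype.card {g : Fin 3 → Bool → Bool // ∀ c : Fin 3 → Bool,
      ((g 0 (c 0) && g 1 (c 1)) && g 2 (c 2)) = ((c 0 && c 1) && c 2)} = 1 := by
  decide +kernel


/-- For the 3-bit XOR task (`β c = c₁ ⊕ c₂ ⊕ c₃`) with exhaustive
support, the number of factored maps `α(c)ᵢ = gᵢ(c_{π(i)})` satisfying
`β (α c) = β c` for all `c ∈ {0,1}³` is exactly `24`; in particular the XOR
task admits strictly more optimal maps than the 3-bit AND task. -/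
theorem stmt_6 :
    Fintype.card
      {p : Equiv.Perm (Fin 3) × (Fin 3 → Bool → Bool) //
        ∀ c : Fin 3 → Bool,
          Bool.xor (Bool.xor ((fun i : Fin 3 => p.2 i (c (p.1 i))) 0)
              ((fun i : Fin 3 => p.2 i (c (p.1 i))) 1))
              ((fun i : Fin 3 => p.2 i (c (p.1 i))) 2) =
            Bool.xor (Bool.xor (c 0) (c 1)) (c 2)} = 24 ∧
    Fintype.card
      {p : Equiv.Perm (Fin 3) × (Fin 3 → Bool → Bool) //
        ∀ c : Fin 3 → Bool,
          (((fun i : Fin 3 => p.2 i (c (p.1 i))) 0 &&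
              (fun i : Fin 3 => p.2 i (c (p.1 i))) 1) &&
              (fun i : Fin 3 => p.2 i (c (p.1 i))) 2) =
            ((c 0 && c 1) && c 2)} <
      Fintype.card
        {p : Equiv.Perm (Fin 3) × (Fin 3 → Bool → Bool) //
          ∀ c : Fin 3 → Bool,
            Bool.xor (Bool.xor ((fun i : Fin 3 => p.2 i (c (p.1 i))) 0)
                ((fun i : Fin 3 => p.2 i (c (p.1 i))) 1))
                ((fun i : Fin 3 => p.2 i (c (p.1 i))) 2) =
              Bool.xor (Bool.xor (c 0) (c 1)) (c 2)} := by
  have hxor := card_factored_maps (fun c => Bool.xor (Bool.xor (c 0) (c 1)) (c 2))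
    xor_fin_three_comp_perm
  have hand := card_factored_maps (fun c => (c 0 && c 1) && c 2) and_fin_three_comp_perm
  rw [card_xor_preserving] at hxor
  rw [card_and_preserving] at hand
  refine ⟨hxor, ?_⟩
  calc
    _ = 6 := hand
    _ < 24 := by norm_num
    _ = _ := hxor.symm
end

section
/- For the 3-bit XOR task with β(c₁,c₂,c₃) = c₁ ⊕ c₂ ⊕ c₃ and a training support consisting of a single concept vector, S = {c₀} for any fixed c₀ ∈ {0,1}³, the number of pairs (π, (g₁,g₂,g₃)), where π is a permutation of {1,2,3} and each gᵢ : {0,1} → {0,1} is an arbitrary unary Boolean function, such that the factored map α(c) = (g₁(c_{π(1)}), g₂(c_{π(2)}), g₃(c_{π(3)})) satisfies β(α(c₀)) = β(c₀), is exactly 192, independently of the choice of c₀. -/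
/-- If a permutation of a finite type exchanges a predicate with its negation, then exactly half
of the elements satisfy the predicate. -/
theorem two_mul_card_subtype_of_perm_not {α : Type*} [Fintype α] (P : α → Prop) [DecidablePred P]
    (e : Equiv.Perm α) (he : ∀ a, P a ↔ ¬ P (e a)) :
    2 * Fintype.card {a // P a} = Fintype.card α := by
  have hcard : Fintype.card {a // P a} = Fintype.card {a // ¬ P a} :=
    Fintype.card_congr (e.subtypeEquiv he)
  have hcompl := Fintype.card_subtype_compl P
  have hle := Fintype.card_subtype_le P
  omega

/-- Negating the first component of a triple of unary Boolean functions. -/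
def negFirst (g : Fin 3 → Bool → Bool) : Fin 3 → Bool → Bool :=
  Function.update g 0 fun b => !g 0 b

theorem negFirst_involutive : Function.Involutive negFirst := by
  intro g
  simp [negFirst]

/-- For the 3-bit XOR task with a singleton support `S = {c₀}`,
the number of factored maps `α(c)ᵢ = gᵢ(c_{π(i)})` satisfying
`β (α c₀) = β c₀` (where `β c = c₁ ⊕ c₂ ⊕ c₃`) is exactly `192`,
independently of the choice of `c₀`. -/
theorem stmt_7 (c₀ : Fin 3 → Bool) :
    Fintype.card
      {p : Equiv.Perm (Fin 3) × (Fin 3 → Bool → Bool) //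
        Bool.xor (Bool.xor ((fun i : Fin 3 => p.2 i (c₀ (p.1 i))) 0)
            ((fun i : Fin 3 => p.2 i (c₀ (p.1 i))) 1))
            ((fun i : Fin 3 => p.2 i (c₀ (p.1 i))) 2) =
          Bool.xor (Bool.xor (c₀ 0) (c₀ 1)) (c₀ 2)} = 192 := by
  have h := two_mul_card_subtype_of_perm_not
    (fun p : Equiv.Perm (Fin 3) × (Fin 3 → Bool → Bool) =>
      Bool.xor (Bool.xor (p.2 0 (c₀ (p.1 0))) (p.2 1 (c₀ (p.1 1)))) (p.2 2 (c₀ (p.1 2))) =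
        Bool.xor (Bool.xor (c₀ 0) (c₀ 1)) (c₀ 2))
    (Equiv.prodCongr (Equiv.refl _) negFirst_involutive.toPerm)
    (fun p => by simp [negFirst])
  have hcard : Fintype.card (Equiv.Perm (Fin 3) × (Fin 3 → Bool → Bool)) = 384 := by
    simp [Fintype.card_perm, Nat.factorial]
  rw [hcard] at h
  exact Nat.eq_of_mul_eq_mul_left two_pos h
end

section
/- Let k ≥ 1 and let β : {0,1}^k → {0,1} be the parity (k-ary XOR) function β(c) = c₁ ⊕ ⋯ ⊕ c_k. For every translation vector t ∈ {0,1}^k of even Hamming weight, the map α(c) = c ⊕ t (bitwise XOR with t) satisfies β(α(c)) = β(c) for every c ∈ {0,1}^k; consequently the k-bit XOR task with exhaustive support admits at least 2^{k−1} distinct optimal maps, so for k ≥ 2 it is affected by reasoning shortcuts. -/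
/-- The parity (k-ary XOR) knowledge `β(c) = c₁ ⊕ ⋯ ⊕ c_k`. -/
def parity (k : ℕ) (c : Fin k → Bool) : Bool :=
  decide (Odd (Finset.univ.filter fun i => c i = true).card)

theorem card_xor_add_two_mul_card_and {ι : Type*} [Fintype ι] (c t : ι → Bool) :
    (Finset.univ.filter fun i => Bool.xor (c i) (t i) = true).card +
        2 * (Finset.univ.filter fun i => (c i && t i) = true).card =
      (Finset.univ.filter fun i => c i = true).card +
        (Finset.univ.filter fun i => t i = true).card := by
  simp only [Finset.card_filter, Finset.mul_sum, ← Finset.sum_add_distrib]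
  refine Finset.sum_congr rfl fun i _ => ?_
  cases c i <;> cases t i <;> rfl

theorem parity_xor_of_even {k : ℕ} (c : Fin k → Bool) {t : Fin k → Bool}
    (ht : Even (Finset.univ.filter fun i => t i = true).card) :
    parity k (fun i => Bool.xor (c i) (t i)) = parity k c := by
  have h := card_xor_add_two_mul_card_and c t
  unfold parity
  rw [decide_eq_decide]
  simp only [Nat.odd_iff, Nat.even_iff] at ht ⊢
  omega

/-- Prepending the parity of a vector gives a vector of even Hamming weight. -/
theorem even_card_cons_parity {n : ℕ} (s : Fin n → Bool) :
    Even (Finset.univ.filter fun i =>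
      (Fin.cons (parity n s) s : Fin (n + 1) → Bool) i = true).card := by
  rw [Finset.card_filter, Fin.sum_univ_succ]
  simp only [Fin.cons_zero, Fin.cons_succ, ← Finset.card_filter, parity, decide_eq_true_eq]
  split_ifs with h
  · rw [add_comm]
    exact h.add_one
  · rw [zero_add]
    exact Nat.not_odd_iff_even.mp h

theorem two_pow_le_card_parity_preserving (n : ℕ) :
    2 ^ n ≤
      Fintype.card
        {α : (Fin (n + 1) → Bool) → (Fin (n + 1) → Bool) //
          ∀ c : Fin (n + 1) → Bool, parity (n + 1) (α c) = parity (n + 1) c} := by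
  let f : (Fin n → Bool) →
      {α : (Fin (n + 1) → Bool) → (Fin (n + 1) → Bool) //
        ∀ c : Fin (n + 1) → Bool, parity (n + 1) (α c) = parity (n + 1) c} := fun s =>
    ⟨fun c i => Bool.xor (c i) ((Fin.cons (parity n s) s : Fin (n + 1) → Bool) i),
      fun c => parity_xor_of_even c (even_card_cons_parity s)⟩
  have hf : Function.Injective f := by
    intro s s' h
    funext i
    simpa [f] using congrFun (congrFun (congrArg Subtype.val h) fun _ => false) i.succ
  simpa using Fintype.card_le_of_injective f hf

/-- For `k ≥ 1` and the parity knowledge on `{0,1}^k`, every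
translation `α(c) = c ⊕ t` by a vector `t` of even Hamming weight is optimal
for exhaustive support; hence the k-bit XOR task admits at least `2^{k-1}`
optimal maps and, for `k ≥ 2`, is affected by reasoning shortcuts. -/
theorem stmt_11 (k : ℕ) (hk : 1 ≤ k) :
    (∀ t : Fin k → Bool,
        Even (Finset.univ.filter fun i => t i = true).card →
        ∀ c : Fin k → Bool,
          parity k (fun i => Bool.xor (c i) (t i)) = parity k c) ∧
    2 ^ (k - 1) ≤
      Fintype.card
        {α : (Fin k → Bool) → (Fin k → Bool) //
          ∀ c : Fin k → Bool, parity k (α c) = parity k c} ∧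
    (2 ≤ k →
      ∃ α : (Fin k → Bool) → (Fin k → Bool),
        (∀ c : Fin k → Bool, parity k (α c) = parity k c) ∧ α ≠ id) := by
  have hcard : 2 ^ (k - 1) ≤
      Fintype.card
        {α : (Fin k → Bool) → (Fin k → Bool) //
          ∀ c : Fin k → Bool, parity k (α c) = parity k c} := by
    obtain ⟨n, rfl⟩ := Nat.exists_eq_add_of_le' hk
    exact two_pow_le_card_parity_preserving n
  refine ⟨fun t ht c => parity_xor_of_even c ht, hcard, fun hk2 => ?_⟩
  have hone : 1 < 2 ^ (k - 1) := Nat.one_lt_two_pow (by omega)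
  obtain ⟨α, hα⟩ := Fintype.exists_ne_of_one_lt_card (hone.trans_le hcard) ⟨id, fun _ => rfl⟩
  exact ⟨α.1, α.2, fun h => hα (Subtype.ext h)⟩
end
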